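/- Let n be a positive integer. Then for every irrational x in the interval [1/n, 1], one has B_n(x) > B_n(η_{n+1}), where η_{n+1} = (√((n+1)²+4) − (n+1))/2. In particular any global minimizer of B_n on the irrationals of (0,1) lies in (0, 1/n). -/

import Mathlib

open Real Set MeasureTheory
open scoped ENNReal

/-- The Gauss map `A(x) = 1/x - ⌊1/x⌋`. -/
noncomputable def gaussMap (x : ℝ) : ℝ := 1 / x - (⌊1 / x⌋ : ℝ)

/-- `brjunoBeta x j = β_{j-1}(x) = ∏_{i=0}^{j-1} A^i(x)`; in particular
`brjunoBeta x 0 = β_{-1}(x) = 1` and `β_K(x) = brjunoBeta x (K+1)`. -/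
noncomputable def brjunoBeta (x : ℝ) (j : ℕ) : ℝ := ∏ i ∈ Finset.range j, gaussMap^[i] x

/-- The σ-Brjuno function `B_σ(x) = Σ_{j≥0} β_{j-1}(x) · (A^j x)^{-1/σ}`, valued in `[0,+∞]`. -/
noncomputable def brjuno (σ x : ℝ) : ℝ≥0∞ :=
  ∑' j : ℕ, ENNReal.ofReal (brjunoBeta x j * (gaussMap^[j] x) ^ (-(1 / σ)))

/-- The K-th partial sum `B_σ^{(K)}(x) = Σ_{j=0}^{K} β_{j-1}(x) · (A^j x)^{-1/σ}`. -/
noncomputable def brjunoPartial (σ x : ℝ) (K : ℕ) : ℝ :=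
  ∑ j ∈ Finset.range (K + 1), brjunoBeta x j * (gaussMap^[j] x) ^ (-(1 / σ))

/-- The fixed point `η_m = (√(m²+4) − m)/2 = [0; m, m, m, ...]` of the Gauss map. -/
noncomputable def eta (m : ℕ) : ℝ := (Real.sqrt ((m : ℝ) ^ 2 + 4) - m) / 2

/-- `b* = (σ+1)^{1+1/σ}/σ`. -/
noncomputable def bstar (σ : ℝ) : ℝ := (σ + 1) ^ (1 + 1 / σ) / σ

/-- The global lower bound `g(x) = x^{-1/σ} + b*·x`. -/
noncomputable def gLow (σ x : ℝ) : ℝ := x ^ (-(1 / σ)) + bstar σ * x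

/-- The cylinder lower bound `g_k(x) = x^{-1/σ} + x·(1/x − k)^{-1/σ} + (1 − kx)·b*`. -/
noncomputable def gCyl (σ : ℝ) (k : ℕ) (x : ℝ) : ℝ :=
  x ^ (-(1 / σ)) + x * (1 / x - (k : ℝ)) ^ (-(1 / σ)) + (1 - (k : ℝ) * x) * bstar σ

lemma gaussMap_irrational {x : ℝ} (hx : Irrational x) : Irrational (gaussMap x) := by
  unfold gaussMap
  rw [one_div]
  exact hx.inv.sub_intCast _

lemma gaussMap_mem_Ioo {x : ℝ} (hx : Irrational x) : gaussMap x ∈ Ioo (0 : ℝ) 1 :=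
  ⟨lt_of_le_of_ne (Int.fract_nonneg (1 / x)) (gaussMap_irrational hx).ne_zero.symm,
    Int.fract_lt_one (1 / x)⟩

lemma gaussMap_iterate_irrational {x : ℝ} (hx : Irrational x) (j : ℕ) :
    Irrational (gaussMap^[j] x) := by
  induction j with
  | zero => exact hx
  | succ j ih =>
    rw [Function.iterate_succ_apply']
    exact gaussMap_irrational ih

lemma gaussMap_iterate_mem_Ioo {x : ℝ} (hx : Irrational x) (h : x ∈ Ioo (0 : ℝ) 1) (j : ℕ) :
    gaussMap^[j] x ∈ Ioo (0 : ℝ) 1 := by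
  cases j with
  | zero => exact h
  | succ j =>
    rw [Function.iterate_succ_apply']
    exact gaussMap_mem_Ioo (gaussMap_iterate_irrational hx j)

lemma brjunoBeta_pos {x : ℝ} (hx : Irrational x) (h : x ∈ Ioo (0 : ℝ) 1) (j : ℕ) :
    0 < brjunoBeta x j :=
  Finset.prod_pos fun i _ => (gaussMap_iterate_mem_Ioo hx h i).1

lemma brjunoBeta_succ (x : ℝ) (j : ℕ) :
    brjunoBeta x (j + 1) = brjunoBeta x j * gaussMap^[j] x :=
  Finset.prod_range_succ _ _

/-- The tangent line at `1` bounds `t ↦ t ^ (-s)` from below. -/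
lemma one_sub_mul_le_rpow_neg {s t : ℝ} (hs : 0 ≤ s) (ht : 0 < t) :
    1 - s * (t - 1) ≤ t ^ (-s) := by
  rw [rpow_def_of_pos ht]
  have h1 := add_one_le_exp (log t * -s)
  have h2 := mul_le_mul_of_nonneg_left (log_le_sub_one_of_pos ht) hs
  linarith

/-- The tangent line at `1 / a` bounds `x ↦ x ^ (-s)` from below. -/
lemma rpow_mul_one_sub_mul_le_rpow_neg {a s x : ℝ} (ha : 0 < a) (hs : 0 ≤ s) (hx : 0 < x) :
    a ^ s * (1 - s * (a * x - 1)) ≤ x ^ (-s) := by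
  have h := one_sub_mul_le_rpow_neg hs (mul_pos ha hx)
  rw [mul_rpow ha.le hx.le, rpow_neg ha.le] at h
  have hp := rpow_pos_of_pos ha s
  calc a ^ s * (1 - s * (a * x - 1)) ≤ a ^ s * ((a ^ s)⁻¹ * x ^ (-s)) :=
        mul_le_mul_of_nonneg_left h hp.le
    _ = x ^ (-s) := by field_simp

lemma bstar_eq {σ : ℝ} (hσ : 0 < σ) : bstar σ = (σ + 1) ^ (1 / σ) * ((σ + 1) / σ) := by
  rw [bstar, rpow_add (by positivity), rpow_one]
  ring

lemma bstar_pos {σ : ℝ} (hσ : 0 < σ) : 0 < bstar σ := by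
  unfold bstar
  positivity

lemma bstar_mul_one_sub_le {σ x : ℝ} (hσ : 0 < σ) (hx : 0 < x) :
    bstar σ * (1 - x) ≤ x ^ (-(1 / σ)) := by
  refine le_trans (le_of_eq ?_)
    (rpow_mul_one_sub_mul_le_rpow_neg (a := σ + 1) (by positivity) (by positivity) hx)
  rw [bstar_eq hσ]
  field_simp
  ring

lemma le_brjunoPartial {σ x : ℝ} (hσ : 0 < σ) (hx : Irrational x) (h : x ∈ Ioo (0 : ℝ) 1)
    (K : ℕ) :
    gLow σ x - bstar σ * brjunoBeta x (K + 1) ≤ brjunoPartial σ x K := by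
  induction K with
  | zero => simp [brjunoPartial, brjunoBeta, gLow]
  | succ K ih =>
    have h1 := mul_le_mul_of_nonneg_left
      (bstar_mul_one_sub_le hσ (gaussMap_iterate_mem_Ioo hx h (K + 1)).1)
      (brjunoBeta_pos hx h (K + 1)).le
    have h2 : brjunoPartial σ x (K + 1) = brjunoPartial σ x K +
        brjunoBeta x (K + 1) * (gaussMap^[K + 1] x) ^ (-(1 / σ)) :=
      Finset.sum_range_succ _ _
    rw [h2, brjunoBeta_succ x (K + 1)]
    linarith

lemma brjuno_term_nonneg {x : ℝ} (σ : ℝ) (hx : Irrational x) (h : x ∈ Ioo (0 : ℝ) 1) (j : ℕ) :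
    0 ≤ brjunoBeta x j * (gaussMap^[j] x) ^ (-(1 / σ)) :=
  mul_nonneg (brjunoBeta_pos hx h j).le (rpow_nonneg (gaussMap_iterate_mem_Ioo hx h j).1.le _)

lemma ofReal_brjunoPartial_le {x : ℝ} (σ : ℝ) (hx : Irrational x) (h : x ∈ Ioo (0 : ℝ) 1)
    (K : ℕ) : ENNReal.ofReal (brjunoPartial σ x K) ≤ brjuno σ x := by
  unfold brjunoPartial brjuno
  rw [ENNReal.ofReal_sum_of_nonneg fun j _ => brjuno_term_nonneg σ hx h j]
  exact ENNReal.sum_le_tsum _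

lemma brjunoBeta_le_term {σ x : ℝ} (hσ : 0 < σ) (hx : Irrational x) (h : x ∈ Ioo (0 : ℝ) 1)
    (j : ℕ) : brjunoBeta x j ≤ brjunoBeta x j * (gaussMap^[j] x) ^ (-(1 / σ)) := by
  have hj := gaussMap_iterate_mem_Ioo hx h j
  refine le_mul_of_one_le_right (brjunoBeta_pos hx h j).le ?_
  exact one_le_rpow_of_pos_of_le_one_of_nonpos hj.1 hj.2.le
    (neg_nonpos.mpr (by positivity))

lemma tendsto_brjunoBeta_zero {σ x : ℝ} (hσ : 0 < σ) (hx : Irrational x)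
    (h : x ∈ Ioo (0 : ℝ) 1) (hB : brjuno σ x ≠ ⊤) :
    Filter.Tendsto (brjunoBeta x) Filter.atTop (nhds 0) := by
  have h1 := (ENNReal.tendsto_toReal ENNReal.zero_ne_top).comp
    (ENNReal.tendsto_atTop_zero_of_tsum_ne_top hB)
  refine squeeze_zero (fun j => (brjunoBeta_pos hx h j).le) (fun j => ?_) h1
  simp only [Function.comp_apply]
  rw [ENNReal.toReal_ofReal (brjuno_term_nonneg σ hx h j)]
  exact brjunoBeta_le_term hσ hx h j

/-- The Brjuno function is bounded below by `gLow`. -/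
lemma ofReal_gLow_le_brjuno {σ x : ℝ} (hσ : 0 < σ) (hx : Irrational x)
    (h : x ∈ Ioo (0 : ℝ) 1) : ENNReal.ofReal (gLow σ x) ≤ brjuno σ x := by
  by_cases hB : brjuno σ x = ⊤
  · rw [hB]
    exact le_top
  · have h1 := (tendsto_brjunoBeta_zero hσ hx h hB).comp (Filter.tendsto_add_atTop_nat 1)
    have h2 := ENNReal.tendsto_ofReal ((h1.const_mul (bstar σ)).const_sub (gLow σ x))
    rw [mul_zero, sub_zero] at h2
    exact le_of_tendsto' h2 fun K =>
      (ENNReal.ofReal_le_ofReal (le_brjunoPartial hσ hx h K)).trans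
        (ofReal_brjunoPartial_le σ hx h K)

lemma gLow_inv_le {σ x : ℝ} (hσ : 0 < σ) (hx : 1 / σ ≤ x) :
    σ ^ (1 / σ) + bstar σ / σ ≤ gLow σ x := by
  have hx0 : 0 < x := lt_of_lt_of_le (by positivity) hx
  have h1 := rpow_mul_one_sub_mul_le_rpow_neg (s := 1 / σ) hσ (by positivity) hx0
  have h2 : σ ^ (1 / σ) ≤ bstar σ := by
    rw [bstar_eq hσ]
    calc σ ^ (1 / σ) ≤ (σ + 1) ^ (1 / σ) :=
          rpow_le_rpow hσ.le (by linarith) (by positivity)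
      _ ≤ _ := le_mul_of_one_le_right (by positivity) (by
          rw [one_le_div hσ]
          linarith)
  have h3 := mul_le_mul_of_nonneg_right h2 (sub_nonneg.mpr hx)
  have h4 : σ ^ (1 / σ) * (1 - 1 / σ * (σ * x - 1)) =
      σ ^ (1 / σ) - σ ^ (1 / σ) * (x - 1 / σ) := by
    field_simp
  unfold gLow
  rw [h4] at h1
  have h5 : bstar σ * (x - 1 / σ) = bstar σ * x - bstar σ / σ := by ring
  linarith

lemma eta_sq (m : ℕ) : eta m ^ 2 + m * eta m = 1 := by
  have h := Real.sq_sqrt (show (0 : ℝ) ≤ (m : ℝ) ^ 2 + 4 by positivity)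
  unfold eta
  linear_combination h / 4

lemma eta_pos (m : ℕ) : 0 < eta m := by
  have : (m : ℝ) < √((m : ℝ) ^ 2 + 4) := Real.lt_sqrt_of_sq_lt (by linarith)
  unfold eta
  linarith

lemma one_div_eta (m : ℕ) : 1 / eta m = m + eta m := by
  have h := eta_pos m
  rw [div_eq_iff h.ne']
  linear_combination -(eta_sq m)

lemma eta_lt_one {m : ℕ} (hm : 0 < m) : eta m < 1 := by
  have h0 := eta_pos m
  have h1 := eta_sq m
  have h2 : (1 : ℝ) ≤ m := by exact_mod_cast hm
  nlinarith

lemma gaussMap_eta {m : ℕ} (hm : 0 < m) : gaussMap (eta m) = eta m := by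
  have h : ⌊1 / eta m⌋ = (m : ℤ) := by
    rw [one_div_eta, Int.floor_eq_iff]
    have := eta_pos m
    have := eta_lt_one hm
    push_cast
    constructor <;> linarith
  unfold gaussMap
  rw [h, one_div_eta]
  push_cast
  ring

lemma eta_irrational {m : ℕ} (hm : 2 ≤ m) : Irrational (eta m) := by
  have h : Irrational (√((m ^ 2 + 4 : ℕ) : ℝ)) := by
    rw [irrational_sqrt_natCast_iff]
    rintro ⟨k, hk⟩
    have h1 : m < k := by nlinarith
    have h2 : k < m + 1 := by nlinarith
    omega
  have h2 := (h.sub_natCast m).div_natCast (m := 2) (by norm_num)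
  unfold eta
  push_cast at h2
  exact h2

lemma brjuno_eta (σ : ℝ) {m : ℕ} (hm : 0 < m) :
    brjuno σ (eta m) = ENNReal.ofReal (eta m ^ (-(1 / σ)) / (1 - eta m)) := by
  have h0 := eta_pos m
  have hit : ∀ j, gaussMap^[j] (eta m) = eta m := fun j =>
    Function.iterate_fixed (gaussMap_eta hm) j
  have hs := (hasSum_geometric_of_lt_one h0.le (eta_lt_one hm)).mul_right
    (eta m ^ (-(1 / σ)))
  unfold brjuno
  simp only [brjunoBeta, hit, Finset.prod_const, Finset.card_range]
  rw [← ENNReal.ofReal_tsum_of_nonneg (fun j => by positivity) hs.summable, hs.tsum_eq]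
  congr 1
  ring

lemma eta_rpow_div_lt {n : ℕ} (hn : 0 < n) :
    eta (n + 1) ^ (-(1 / (n : ℝ))) / (1 - eta (n + 1)) <
      (n : ℝ) ^ (1 / (n : ℝ)) + bstar n / n := by
  have he0 := eta_pos (n + 1)
  have he1 := eta_lt_one (Nat.succ_pos n)
  have hinv := one_div_eta (n + 1)
  have hsq := eta_sq (n + 1)
  push_cast at hinv hsq
  set e := eta (n + 1)
  have hn1 : (1 : ℝ) ≤ n := by exact_mod_cast hn
  rw [bstar_eq (by positivity)]
  generalize (n : ℝ) = N at *
  have hN : 0 < N := by linarith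
  have hs1 : 1 / N ≤ 1 := by rw [div_le_one hN]; exact hn1
  have hs0 : 0 ≤ 1 / N := by positivity
  have hA : 0 < (N + 1) ^ (1 / N) := by positivity
  have hup : e ^ (-(1 / N)) ≤ (N + 1) ^ (1 / N) * (1 + 1 / N * (e / (N + 1))) := by
    rw [rpow_neg he0.le, ← inv_rpow he0.le, ← one_div e, hinv,
      show N + 1 + e = (N + 1) * (1 + e / (N + 1)) by field_simp,
      mul_rpow (by positivity) (by positivity)]
    have hb : -1 ≤ e / (N + 1) := le_trans (by norm_num) (by positivity : 0 ≤ e / (N + 1))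
    exact mul_le_mul_of_nonneg_left (rpow_one_add_le_one_add_mul_self hb hs0 hs1) hA.le
  have hlow : (N + 1) ^ (1 / N) * (N ^ 2 / (N ^ 2 + 1)) ≤ N ^ (1 / N) := by
    have hb : -1 ≤ 1 / N := by linarith
    have h1 := mul_le_mul_of_nonneg_left (rpow_one_add_le_one_add_mul_self hb hs0 hs1)
      (rpow_nonneg hN.le (1 / N))
    rw [← mul_rpow hN.le (by positivity), show N * (1 + 1 / N) = N + 1 by field_simp] at h1
    calc _ ≤ N ^ (1 / N) * (1 + 1 / N * (1 / N)) * (N ^ 2 / (N ^ 2 + 1)) :=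
          mul_le_mul_of_nonneg_right h1 (by positivity)
      _ = N ^ (1 / N) := by field_simp
  have hrat : (1 + 1 / N * (e / (N + 1))) <
      (N ^ 2 / (N ^ 2 + 1) + (N + 1) / N / N) * (1 - e) := by
    have hL : 1 + 1 / N * (e / (N + 1)) = (1 + 1 / N) * (1 - e) + e ^ 3 / (N * (N + 1)) := by
      field_simp
      linear_combination -(e - (N + 1)) * hsq
    have hR : (N ^ 2 / (N ^ 2 + 1) + (N + 1) / N / N) * (1 - e) =
        (1 + 1 / N) * (1 - e) + (N + e) * e / (N ^ 2 * (N ^ 2 + 1)) := by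
      rw [show (N + e) * e = 1 - e by linear_combination hsq]
      field_simp
      ring
    have hmul : (N + 1) * e < 1 := by nlinarith
    have hcube : e ^ 2 * (N * (N ^ 2 + 1)) < (N + e) * (N + 1) := by
      have h1 : ((N + 1) * e) ^ 2 < 1 := pow_lt_one₀ (by positivity) hmul (by norm_num)
      have h2 : N * (N ^ 2 + 1) ≤ N * (N + 1) ^ 2 := by nlinarith
      have h3 := mul_le_mul_of_nonneg_left h2 (sq_nonneg e)
      have h4 := mul_lt_mul_of_pos_left h1 hN
      nlinarith
    rw [hL, hR, add_lt_add_iff_left, div_lt_div_iff₀ (by positivity) (by positivity)]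
    have h := mul_lt_mul_of_pos_left hcube (mul_pos he0 hN)
    linarith
  rw [div_lt_iff₀ (by linarith)]
  calc _ ≤ _ := hup
    _ < (N + 1) ^ (1 / N) * ((N ^ 2 / (N ^ 2 + 1) + (N + 1) / N / N) * (1 - e)) :=
        mul_lt_mul_of_pos_left hrat hA
    _ = ((N + 1) ^ (1 / N) * (N ^ 2 / (N ^ 2 + 1)) +
        (N + 1) ^ (1 / N) * ((N + 1) / N) / N) * (1 - e) := by ring
    _ ≤ _ := by gcongr

/-- a priori estimate: `B_n(x) > B_n(η_{n+1})` for all irrational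
`x ∈ [1/n, 1]`; in particular any global minimizer lies in `(0, 1/n)`. -/
theorem brjuno_apriori_estimate (n : ℕ) (hn : 0 < n) :
    (∀ x : ℝ, Irrational x → x ∈ Set.Icc (1 / (n : ℝ)) 1 →
      brjuno n (eta (n + 1)) < brjuno n x) ∧
    (∀ r : ℝ, Irrational r → r ∈ Set.Ioo (0 : ℝ) 1 →
      (∀ x : ℝ, Irrational x → x ∈ Set.Ioo (0 : ℝ) 1 → brjuno n r ≤ brjuno n x) →
      r ∈ Set.Ioo (0 : ℝ) (1 / (n : ℝ))) := by
  have hn0 : (0 : ℝ) < n := by exact_mod_cast hn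
  have key : ∀ x : ℝ, Irrational x → x ∈ Set.Icc (1 / (n : ℝ)) 1 →
      brjuno n (eta (n + 1)) < brjuno n x := by
    intro x hx hmem
    have hx01 : x ∈ Ioo (0 : ℝ) 1 :=
      ⟨lt_of_lt_of_le (by positivity) hmem.1, lt_of_le_of_ne hmem.2 hx.ne_one⟩
    refine lt_of_lt_of_le ?_ (ofReal_gLow_le_brjuno hn0 hx hx01)
    have hlt := (eta_rpow_div_lt hn).trans_le (gLow_inv_le hn0 hmem.1)
    rw [brjuno_eta _ (Nat.succ_pos n)]
    refine (ENNReal.ofReal_lt_ofReal_iff_of_nonneg ?_).mpr hlt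
    exact div_nonneg (rpow_nonneg (eta_pos _).le _)
      (sub_nonneg.mpr (eta_lt_one (Nat.succ_pos n)).le)
  refine ⟨key, fun r hr hmem hmin => ⟨hmem.1, ?_⟩⟩
  by_contra! hge
  exact (key r hr ⟨hge, hmem.2.le⟩).not_ge
    (hmin _ (eta_irrational (by omega)) ⟨eta_pos _, eta_lt_one (Nat.succ_pos n)⟩)
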